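/- Let ε ∈ (0,1/2], let N, r, p be positive integers, let x ∈ ℝ^N with x ≠ 0, and let x̂_1, …, x̂_p ∈ ℝ^N. Let Ψ be an r × N real matrix such that (1-ε)·‖x‖₂ ≤ ‖Ψx‖₂ ≤ (1+ε)·‖x‖₂ and, for every j ∈ {1, …, p}, (1-ε)·‖x - x̂_j‖₂ ≤ ‖Ψ(x - x̂_j)‖₂ ≤ (1+ε)·‖x - x̂_j‖₂. Then ‖Ψx‖₂ > 0, and for every j ∈ {1, …, p}: ((1-3ε)/((1+ε)(1-ε)²))·(‖Ψ(x - x̂_j)‖₂/‖Ψx‖₂) ≤ ‖x - x̂_j‖₂/‖x‖₂ ≤ (1/(1-ε)²)·(‖Ψ(x - x̂_j)‖₂/‖Ψx‖₂). -/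

import Mathlib

/-- If measured lengths `A`, `E` agree with the lengths `a`, `e` up to factors in `[1 - ε, 1 + ε]`,
then the measured ratio `E / A` is at most `(1 + ε) / (1 - ε)` times the ratio `e / a`. -/
lemma div_le_distortion_mul_div {ε a A e E : ℝ} (hε : ε < 1) (ha : 0 < a) (hE₀ : 0 ≤ E)
    (hA : (1 - ε) * a ≤ A) (hE : E ≤ (1 + ε) * e) :
    E / A ≤ (1 + ε) / (1 - ε) * (e / a) := by
  have h : 0 < (1 - ε) * a := mul_pos (sub_pos.2 hε) ha
  calc E / A ≤ (1 + ε) * e / ((1 - ε) * a) := div_le_div₀ (hE₀.trans hE) hE h hA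
    _ = (1 + ε) / (1 - ε) * (e / a) := mul_div_mul_comm _ _ _ _

/-- If measured lengths `A`, `E` agree with the lengths `a`, `e` up to factors in `[1 - ε, 1 + ε]`,
then the ratio `e / a` is at most `(1 + ε) / (1 - ε)` times the measured ratio `E / A`. -/
lemma div_le_distortion_mul_measured_div {ε a A e E : ℝ} (hε : ε < 1) (ha : 0 < a)
    (hA₀ : 0 < A) (he : 0 ≤ e) (hA : A ≤ (1 + ε) * a) (hE : (1 - ε) * e ≤ E) :
    e / a ≤ (1 + ε) / (1 - ε) * (E / A) := by
  have h : 0 < 1 - ε := sub_pos.2 hε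
  rw [← mul_div_mul_comm, div_le_div_iff₀ ha (mul_pos h hA₀)]
  calc e * ((1 - ε) * A) = (1 - ε) * e * A := by ring
    _ ≤ E * ((1 + ε) * a) := mul_le_mul hE hA hA₀.le ((mul_nonneg h.le he).trans hE)
    _ = (1 + ε) * E * a := by ring

lemma one_sub_three_mul_div_mul_le {ε : ℝ} (hε₀ : 0 ≤ ε) (hε : ε < 1) :
    (1 - 3 * ε) / ((1 + ε) * (1 - ε) ^ 2) * ((1 + ε) / (1 - ε)) ≤ 1 := by
  have h : 0 < 1 - ε := sub_pos.2 hε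
  have h' : 0 < 1 + ε := by positivity
  rw [div_mul_div_comm, div_le_one (by positivity)]
  nlinarith [mul_nonneg h'.le (mul_nonneg (sq_nonneg ε) (show 0 ≤ 3 - ε by linarith))]

lemma one_add_div_one_sub_le {ε : ℝ} (hε : ε < 1) :
    (1 + ε) / (1 - ε) ≤ 1 / (1 - ε) ^ 2 := by
  have h : 0 < 1 - ε := sub_pos.2 hε
  rw [div_le_div_iff₀ h (by positivity)]
  nlinarith [mul_nonneg h.le (sq_nonneg ε)]

/-- Bound (2a) of Theorem 4.1 (deterministic content): if `Ψ` preserves the norms of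
`x` and of the error vectors `x - x̂_j` to within `(1 ± ε)`, then the observable
normalized quantities `‖Ψ(x - x̂_j)‖₂/‖Ψx‖₂` bound the relative errors
`‖x - x̂_j‖₂/‖x‖₂` from above and below. -/
theorem stmt_6 (ε : ℝ) (hε : ε ∈ Set.Ioc (0 : ℝ) (1 / 2)) (N r p : ℕ)
    (hN : 0 < N) (hr : 0 < r) (hp : 0 < p)
    (x : Fin N → ℝ) (hx : x ≠ 0) (xhat : Fin p → Fin N → ℝ)
    (Ψ : Matrix (Fin r) (Fin N) ℝ)
    (hΨx : (1 - ε) * Real.sqrt (∑ i, (x i) ^ 2) ≤ Real.sqrt (∑ i, (Ψ.mulVec x i) ^ 2) ∧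
      Real.sqrt (∑ i, (Ψ.mulVec x i) ^ 2) ≤ (1 + ε) * Real.sqrt (∑ i, (x i) ^ 2))
    (hΨ : ∀ j : Fin p,
      (1 - ε) * Real.sqrt (∑ i, (x i - xhat j i) ^ 2)
          ≤ Real.sqrt (∑ i, (Ψ.mulVec (x - xhat j) i) ^ 2) ∧
        Real.sqrt (∑ i, (Ψ.mulVec (x - xhat j) i) ^ 2)
          ≤ (1 + ε) * Real.sqrt (∑ i, (x i - xhat j i) ^ 2)) :
    0 < Real.sqrt (∑ i, (Ψ.mulVec x i) ^ 2) ∧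
      ∀ j : Fin p,
        ((1 - 3 * ε) / ((1 + ε) * (1 - ε) ^ 2)) *
            (Real.sqrt (∑ i, (Ψ.mulVec (x - xhat j) i) ^ 2) /
              Real.sqrt (∑ i, (Ψ.mulVec x i) ^ 2))
          ≤ Real.sqrt (∑ i, (x i - xhat j i) ^ 2) / Real.sqrt (∑ i, (x i) ^ 2) ∧
        Real.sqrt (∑ i, (x i - xhat j i) ^ 2) / Real.sqrt (∑ i, (x i) ^ 2)
          ≤ (1 / (1 - ε) ^ 2) *
            (Real.sqrt (∑ i, (Ψ.mulVec (x - xhat j) i) ^ 2) /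
              Real.sqrt (∑ i, (Ψ.mulVec x i) ^ 2)) := by
  obtain ⟨hε₀, hε₁⟩ := hε
  have hε : ε < 1 := by linarith
  have ha : 0 < Real.sqrt (∑ i, (x i) ^ 2) := by
    obtain ⟨i, hi⟩ := Function.ne_iff.1 hx
    exact Real.sqrt_pos.2 <| Finset.sum_pos' (fun _ _ => sq_nonneg _)
      ⟨i, Finset.mem_univ i, sq_pos_of_ne_zero hi⟩
  have hA : 0 < Real.sqrt (∑ i, (Ψ.mulVec x i) ^ 2) :=
    (mul_pos (sub_pos.2 hε) ha).trans_le hΨx.1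
  refine ⟨hA, fun j => ⟨?_, ?_⟩⟩
  · set R := Real.sqrt (∑ i, (Ψ.mulVec (x - xhat j) i) ^ 2) /
      Real.sqrt (∑ i, (Ψ.mulVec x i) ^ 2) with hR
    have hR₀ : 0 ≤ R := by positivity
    have hle := div_le_distortion_mul_div hε ha (Real.sqrt_nonneg _) hΨx.1 (hΨ j).2
    rw [← hR] at hle
    set q := Real.sqrt (∑ i, (x i - xhat j i) ^ 2) / Real.sqrt (∑ i, (x i) ^ 2)
    have hq : 0 ≤ q := by positivity
    rcases le_total (1 - 3 * ε) 0 with h | h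
    · exact (mul_nonpos_of_nonpos_of_nonneg
        (div_nonpos_of_nonpos_of_nonneg h (by positivity)) hR₀).trans hq
    · calc _ ≤ (1 - 3 * ε) / ((1 + ε) * (1 - ε) ^ 2) * ((1 + ε) / (1 - ε) * q) :=
            mul_le_mul_of_nonneg_left hle (by positivity)
        _ = (1 - 3 * ε) / ((1 + ε) * (1 - ε) ^ 2) * ((1 + ε) / (1 - ε)) * q := by ring
        _ ≤ q := mul_le_of_le_one_left hq (one_sub_three_mul_div_mul_le hε₀.le hε)
  · exact (div_le_distortion_mul_measured_div hε ha hA (Real.sqrt_nonneg _) hΨx.2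
      (hΨ j).1).trans (mul_le_mul_of_nonneg_right (one_add_div_one_sub_le hε) (by positivity))
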